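/- Let u : [0, a] × [0, T] → ℝ be Lipschitz continuous and a viscosity subsolution of u_t + H(s, u') = 0 on (0, a) × (0, T), with H(s, ·) convex for each s and H continuous. Then for any absolutely continuous curve η : [t₁, t₂] → [0, a] with 0 ≤ t₁ < t₂ ≤ T, u(η(t₂), t₂) − u(η(t₁), t₁) ≤ ∫_{t₁}^{t₂} L(η(t), η̇(t)) dt, where L(s, λ) = sup_μ (μλ − H(s, μ)). -/

import Mathlib

open Set Filter Topology MeasureTheory

/-- The Fenchel conjugate of `H s` at `v`, with the supremum restricted to momenta in `[-R, R]`. -/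
noncomputable def truncatedConjugate (H : ℝ → ℝ → ℝ) (R s v : ℝ) : ℝ :=
  sSup ((fun μ => μ * v - H s μ) '' Icc (-R) R)

theorem continuous_truncatedConjugate {H : ℝ → ℝ → ℝ}
    (hH : Continuous (fun p : ℝ × ℝ => H p.1 p.2)) (R : ℝ) :
    Continuous (fun p : ℝ × ℝ => truncatedConjugate H R p.1 p.2) := by
  have hf : Continuous (fun q : (ℝ × ℝ) × ℝ => q.2 * q.1.2 - H q.1.1 q.2) :=
    (by fun_prop : Continuous fun q : (ℝ × ℝ) × ℝ => q.2 * q.1.2).sub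
      (hH.comp (by fun_prop : Continuous fun q : (ℝ × ℝ) × ℝ => (q.1.1, q.2)))
  exact isCompact_Icc.continuous_sSup
    (f := fun (p : ℝ × ℝ) (μ : ℝ) => μ * p.2 - H p.1 μ) hf

theorem le_truncatedConjugate {H : ℝ → ℝ → ℝ}
    (hH : Continuous (fun p : ℝ × ℝ => H p.1 p.2)) {R μ : ℝ} (s v : ℝ) (hμ : μ ∈ Icc (-R) R) :
    μ * v - H s μ ≤ truncatedConjugate H R s v := by
  have hf : Continuous (fun μ : ℝ => μ * v - H s μ) :=
    (by fun_prop : Continuous fun μ : ℝ => μ * v).sub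
      (hH.comp (by fun_prop : Continuous fun μ : ℝ => (s, μ)))
  exact le_csSup (isCompact_Icc.image hf).bddAbove (mem_image_of_mem _ hμ)

/-- For superlinear `H` and bounded velocities, only momenta in a bounded interval contribute to
the Fenchel conjugate. -/
theorem exists_forall_sSup_eq_truncatedConjugate {H : ℝ → ℝ → ℝ} {a : ℝ}
    (hH : Continuous (fun p : ℝ × ℝ => H p.1 p.2))
    (hsuper : ∀ C > (0 : ℝ), ∃ R : ℝ, ∀ s ∈ Icc 0 a, ∀ μ : ℝ, H s μ ≥ C * |μ| - R)
    {M : ℝ} (hM : 0 ≤ M) :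
    ∃ R₀ : ℝ, ∀ R ≥ R₀, ∀ s ∈ Icc 0 a, ∀ v : ℝ, |v| ≤ M →
      sSup (range fun μ => μ * v - H s μ) = truncatedConjugate H R s v := by
  obtain ⟨B, hB⟩ := hsuper (M + 1) (by linarith)
  have hH₀ : Continuous (fun s : ℝ => H s 0) :=
    hH.comp (by fun_prop : Continuous fun s : ℝ => (s, (0 : ℝ)))
  obtain ⟨A, hA⟩ := (isCompact_Icc (a := (0 : ℝ)) (b := a)).bddAbove_image hH₀.continuousOn
  refine ⟨max 0 (B + A), fun R hR s hs v hv => ?_⟩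
  have hR0 : 0 ≤ R := (le_max_left _ _).trans hR
  have hRA : B + A ≤ R := (le_max_right _ _).trans hR
  have hub : ∀ μ : ℝ, μ * v - H s μ ≤ truncatedConjugate H R s v := by
    intro μ
    by_cases hμ : |μ| ≤ R
    · exact le_truncatedConjugate hH s v (abs_le.1 hμ)
    · have h0 := le_truncatedConjugate hH (R := R) (μ := 0) s v ⟨by linarith, hR0⟩
      have h1 := hB s hs μ
      have h2 : H s 0 ≤ A := hA (mem_image_of_mem _ hs)
      have h3 : μ * v ≤ |μ| * M :=
        (le_abs_self _).trans (by rw [abs_mul]; gcongr)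
      push Not at hμ
      nlinarith
  refine le_antisymm (csSup_le (range_nonempty _) ?_) ?_
  · rintro _ ⟨μ, rfl⟩
    exact hub μ
  · refine csSup_le_csSup ⟨truncatedConjugate H R s v, ?_⟩ ((nonempty_Icc.2 (by linarith)).image _) (image_subset_range _ _)
    rintro _ ⟨μ, rfl⟩
    exact hub μ

/-- A continuous function with `w t₁ < w t₂`, after subtracting a suitable strictly increasing
`C¹` function, is larger at some interior point than at both endpoints. -/
theorem exists_increasing_barrier {w : ℝ → ℝ} {t₁ t₂ : ℝ} (ht : t₁ < t₂)
    (hw : ContinuousOn w (Icc t₁ t₂)) (h : w t₁ < w t₂) :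
    ∃ q q' : ℝ → ℝ, ∃ c > (0 : ℝ), ∃ t₀ ∈ Ioo t₁ t₂,
      (∀ t, HasDerivAt q (q' t) t) ∧ Continuous q' ∧ (∀ t, c ≤ q' t) ∧
      w t₁ - q t₁ + c ≤ w t₀ - q t₀ ∧ w t₂ - q t₂ + c ≤ w t₀ - q t₀ := by
  set Δ := w t₂ - w t₁ with hΔ
  have hΔ0 : 0 < Δ := sub_pos.2 h
  obtain ⟨t₀, ht₀, hwt₀⟩ : ∃ t₀ ∈ Ioo t₁ t₂, w t₁ + Δ / 2 < w t₀ := by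
    have h1 : ∀ᶠ t in 𝓝[Ioo t₁ t₂] t₂, w t₁ + Δ / 2 < w t :=
      ((hw t₂ (right_mem_Icc.2 ht.le)).mono Ioo_subset_Icc_self).eventually
        (lt_mem_nhds (by linarith))
    have : (𝓝[Ioo t₁ t₂] t₂).NeBot := by
      rw [nhdsWithin_Ioo_eq_nhdsLT ht]; infer_instance
    obtain ⟨t, ht1, ht2⟩ := (eventually_mem_nhdsWithin.and h1).exists
    exact ⟨t, ht1, ht2⟩
  have hd : 0 < t₂ - t₀ := sub_pos.2 ht₀.2
  have hl : 0 < t₂ - t₁ := sub_pos.2 ht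
  set N := 8 / (t₂ - t₀) with hN
  have hN0 : 0 < N := by positivity
  set e := Δ / (8 * (t₂ - t₁)) with he
  have he0 : 0 < e := by positivity
  have hel : e * (t₂ - t₁) = Δ / 8 := by rw [he]; field_simp
  have hNd : N * (t₂ - t₀) = 8 := by rw [hN]; field_simp
  refine ⟨fun t => e * (t - t₁) + Δ / 8 * Real.exp (N * (t - t₀)),
    fun t => e + Δ / 8 * (Real.exp (N * (t - t₀)) * N), min e (Δ / 4), by positivity,
    t₀, ht₀, fun t => ?_, by fun_prop, fun t => ?_, ?_, ?_⟩
  · have h1 : HasDerivAt (fun t => e * (t - t₁)) (e * 1) t :=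
      ((hasDerivAt_id t).sub_const t₁).const_mul e
    have h2 : HasDerivAt (fun t => N * (t - t₀)) (N * 1) t :=
      ((hasDerivAt_id t).sub_const t₀).const_mul N
    have h3 := h1.add (h2.exp.const_mul (Δ / 8))
    simp only [mul_one] at h3
    exact h3
  · have : 0 ≤ Δ / 8 * (Real.exp (N * (t - t₀)) * N) := by positivity
    linarith [min_le_left e (Δ / 4)]
  · have h1 := min_le_right e (Δ / 4)
    have h2 : 0 ≤ Δ / 8 * Real.exp (N * (t₁ - t₀)) := by positivity
    have h3 : e * (t₀ - t₁) ≤ e * (t₂ - t₁) := by nlinarith [ht₀.2]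
    simp only [sub_self, mul_zero, Real.exp_zero, mul_one]
    linarith
  · have h1 := min_le_right e (Δ / 4)
    have h2 : e * (t₀ - t₁) ≤ e * (t₂ - t₁) := by nlinarith [ht₀.2]
    have h3 := Real.add_one_le_exp (N * (t₂ - t₀))
    rw [hNd] at h3
    simp only [sub_self, mul_zero, Real.exp_zero, mul_one, hNd]
    nlinarith

/-- The curve estimate for `C¹` curves staying away from the endpoints of `[0, a]`, with the
supremum in the Lagrangian restricted to momenta bounded by twice the Lipschitz constant. -/
theorem curve_estimate_of_continuous_deriv {a T : ℝ} {H : ℝ → ℝ → ℝ}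
    (hH : Continuous (fun p : ℝ × ℝ => H p.1 p.2)) {u : ℝ × ℝ → ℝ} {K : NNReal}
    (hu : LipschitzOnWith K u (Icc 0 a ×ˢ Icc 0 T))
    (hsub : ∀ φ : ℝ × ℝ → ℝ, ContDiff ℝ 1 φ →
      ∀ s₀ ∈ Ioo (0 : ℝ) a, ∀ t₀ ∈ Ioo (0 : ℝ) T,
      IsLocalMax (fun p => u p - φ p) (s₀, t₀) →
      deriv (fun τ => φ (s₀, τ)) t₀ + H s₀ (deriv (fun σ => φ (σ, t₀)) s₀) ≤ 0)
    {t₁ t₂ : ℝ} (ht₁ : 0 ≤ t₁) (ht : t₁ < t₂) (ht₂ : t₂ ≤ T)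
    {η η' : ℝ → ℝ} (hη : ∀ t, HasDerivAt η (η' t) t) (hη' : Continuous η')
    {d : ℝ} (hd : 0 < d) (hmem : ∀ t ∈ Icc t₁ t₂, η t ∈ Icc d (a - d))
    {R : ℝ} (hR : 2 * K ≤ R) :
    u (η t₂, t₂) - u (η t₁, t₁) ≤ ∫ t in t₁..t₂, truncatedConjugate H R (η t) (η' t) := by
  have hηc : Continuous η := continuous_iff_continuousAt.2 fun t => (hη t).continuousAt
  have hK : (0 : ℝ) ≤ K := K.coe_nonneg
  have hmem' : ∀ t ∈ Icc t₁ t₂, η t ∈ Icc 0 a := fun t htt =>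
    ⟨by linarith [(hmem t htt).1], by linarith [(hmem t htt).2]⟩
  have hIcc : ∀ t ∈ Icc t₁ t₂, t ∈ Icc 0 T := fun t htt =>
    ⟨ht₁.trans htt.1, htt.2.trans ht₂⟩
  set l : ℝ → ℝ := fun t => truncatedConjugate H R (η t) (η' t) with hl
  have hlc : Continuous l := (continuous_truncatedConjugate hH R).comp (hηc.prodMk hη')
  set G : ℝ → ℝ := fun t => ∫ τ in t₁..t, l τ with hG
  have hGd : ∀ t, HasDerivAt G (l t) t := fun t =>
    intervalIntegral.integral_hasDerivAt_right (hlc.intervalIntegrable _ _)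
      (hlc.stronglyMeasurableAtFilter _ _) hlc.continuousAt
  have hGc : Continuous G := continuous_iff_continuousAt.2 fun t => (hGd t).continuousAt
  by_contra! hcon
  have hwc : ContinuousOn (fun t => u (η t, t) - G t) (Icc t₁ t₂) :=
    (hu.continuousOn.comp (f := fun t => (η t, t)) (hηc.prodMk continuous_id).continuousOn
      fun t htt => ⟨hmem' t htt, hIcc t htt⟩).sub hGc.continuousOn
  have hG₁ : G t₁ = 0 := intervalIntegral.integral_same
  obtain ⟨q, q', c, hc, t₀, ht₀, hq, hq'c, hq', hw₁, hw₂⟩ :=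
    exists_increasing_barrier ht hwc (by simp only [hG₁]; change G t₂ < _ at hcon; linarith)
  have hqc : Continuous q := continuous_iff_continuousAt.2 fun t => (hq t).continuousAt
  obtain ⟨ρ, hρ, hρH⟩ : ∃ ρ > (0 : ℝ), ∀ s ∈ Icc 0 a, ∀ s' ∈ Icc 0 a, ∀ p ∈ Icc (-R) R,
      |s - s'| < ρ → |H s p - H s' p| < c := by
    obtain ⟨ρ, hρ, h⟩ := Metric.uniformContinuousOn_iff.1
      ((isCompact_Icc (a := (0 : ℝ)) (b := a)).prod
        (isCompact_Icc (a := -R) (b := R))|>.uniformContinuousOn_of_continuous hH.continuousOn)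
        c hc
    refine ⟨ρ, hρ, fun s hs s' hs' p hp hss => ?_⟩
    have := h (s, p) ⟨hs, hp⟩ (s', p) ⟨hs', hp⟩ (by
      rw [Prod.dist_eq]; simp [Real.dist_eq, hss])
    simpa [Real.dist_eq] using this
  obtain ⟨ε, hε, hεd, hερ, hεc⟩ : ∃ ε > (0 : ℝ), K * ε < d ∧ K * ε < ρ ∧ K * (K * ε) < c := by
    have h (b x : ℝ) (hx : 0 < x) : ∀ᶠ ε in 𝓝[>] (0 : ℝ), b * ε < x := by
      have : Tendsto (fun ε : ℝ => b * ε) (𝓝[>] 0) (𝓝 (b * 0)) :=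
        ((continuous_const_mul b).tendsto 0).mono_left nhdsWithin_le_nhds
      rw [mul_zero] at this
      exact this.eventually_lt_const hx
    obtain ⟨ε, h1, h2, h3, h4⟩ := ((eventually_mem_nhdsWithin (a := (0 : ℝ)) (s := Ioi 0)).and
      ((h K d hd).and ((h K ρ hρ).and (h (K * K) c hc)))).exists
    exact ⟨ε, h1, h2, h3, by rwa [← mul_assoc]⟩
  set φ : ℝ × ℝ → ℝ := fun p => G p.2 + q p.2 + (p.1 - η p.2) ^ 2 / ε with hφ
  have contDiff_of {f f' : ℝ → ℝ} (hf : ∀ t, HasDerivAt f (f' t) t) (hf' : Continuous f') :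
      ContDiff ℝ 1 f := by
    rw [contDiff_one_iff_deriv]
    exact ⟨fun t => (hf t).differentiableAt, by rwa [funext fun t => (hf t).deriv]⟩
  have hφC : ContDiff ℝ 1 φ := by
    have h1 := contDiff_of hGd hlc
    have h2 := contDiff_of hq hq'c
    have h3 := contDiff_of hη hη'
    fun_prop
  have hφc : Continuous φ := hφC.continuous
  have hcomp : IsCompact (Icc (0 : ℝ) a ×ˢ Icc t₁ t₂) := isCompact_Icc.prod isCompact_Icc
  have hsubset : Icc (0 : ℝ) a ×ˢ Icc t₁ t₂ ⊆ Icc 0 a ×ˢ Icc 0 T := prod_mono_right hIcc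
  have ht₀' := Ioo_subset_Icc_self ht₀
  obtain ⟨⟨s, t⟩, ⟨hs, htt⟩, hmax⟩ := hcomp.exists_isMaxOn (f := fun p => u p - φ p)
    ⟨(η t₀, t₀), hmem' _ ht₀', ht₀'⟩ ((hu.continuousOn.mono hsubset).sub hφc.continuousOn)
  simp only at hs htt
  have hlip : u (s, t) - u (η t, t) ≤ K * |s - η t| := by
    have := hu.dist_le_mul (s, t) ⟨hs, hIcc t htt⟩ (η t, t) ⟨hmem' t htt, hIcc t htt⟩
    rw [Prod.dist_eq] at this
    simp only [dist_self, Real.dist_eq, abs_nonneg, sup_of_le_left] at this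
    exact (le_abs_self _).trans this
  have hclose : |s - η t| ≤ K * ε := by
    have h1 := hmax (show (η t, t) ∈ _ from ⟨hmem' t htt, htt⟩)
    simp only [hφ, mem_ofPred_eq, sub_self] at h1
    have h2 : (s - η t) ^ 2 / ε ≤ K * |s - η t| := by
      norm_num at h1
      linarith
    rw [div_le_iff₀ hε, ← sq_abs] at h2
    by_contra! h3
    have : 0 < |s - η t| := lt_of_le_of_lt (by positivity) h3
    nlinarith
  have hval : u (η t₀, t₀) - G t₀ - q t₀ ≤ u (η t, t) - G t - q t + K * (K * ε) := by
    have h1 := hmax (show (η t₀, t₀) ∈ _ from ⟨hmem' _ ht₀', ht₀'⟩)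
    simp only [hφ, mem_ofPred_eq, sub_self] at h1
    have h2 : 0 ≤ (s - η t) ^ 2 / ε := by positivity
    have h3 : K * |s - η t| ≤ K * (K * ε) := by gcongr
    norm_num at h1
    linarith
  have htne₁ : t₁ ≠ t := by rintro rfl; linarith
  have htne₂ : t ≠ t₂ := by rintro rfl; linarith
  have htI : t ∈ Ioo t₁ t₂ := ⟨lt_of_le_of_ne htt.1 htne₁, lt_of_le_of_ne htt.2 htne₂⟩
  have hsI : s ∈ Ioo 0 a := by
    have h1 := abs_le.1 hclose
    have h2 := hmem t htt
    exact ⟨by linarith [h2.1], by linarith [h2.2]⟩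
  have hloc : IsLocalMax (fun p => u p - φ p) (s, t) :=
    hmax.isLocalMax (prod_mem_nhds (Icc_mem_nhds hsI.1 hsI.2) (Icc_mem_nhds htI.1 htI.2))
  have key := hsub φ hφC s hsI t ⟨ht₁.trans_lt htI.1, htI.2.trans_le ht₂⟩ hloc
  set p := 2 * (s - η t) / ε with hp
  have hφt : HasDerivAt (fun τ => φ (s, τ)) (l t + q' t - p * η' t) t := by
    have h1 := ((hGd t).add (hq t)).add ((((hη t).const_sub s).pow 2).div_const ε)
    refine h1.congr_deriv ?_
    rw [hp]; push_cast; ring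
  have hφs : HasDerivAt (fun σ => φ (σ, t)) p s := by
    have h1 := ((((hasDerivAt_id s).sub_const (η t)).pow 2).div_const ε).const_add (G t + q t)
    refine h1.congr_deriv ?_
    rw [hp]; simp
  rw [hφt.deriv, hφs.deriv] at key
  have hpR : p ∈ Icc (-R) R := by
    refine abs_le.1 (le_trans ?_ hR)
    rw [hp, abs_div, abs_mul, abs_of_pos hε, div_le_iff₀ hε]
    norm_num
    linarith
  have h1 := le_truncatedConjugate hH (η t) (η' t) hpR
  have h2 := (abs_lt.1 (hρH s hs (η t) (hmem' t htt) p hpR (hclose.trans_lt hερ))).1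
  have h3 := hq' t
  change p * η' t - H (η t) p ≤ l t at h1
  linarith

/-- A Lipschitz function with values in `[0, a]` is a limit of `C¹` functions with values in the
open interval and the same Lipschitz bound, with derivatives converging wherever `ζ` is
differentiable. -/
theorem exists_contDiff_interior_approximation {a : ℝ} (ha : 0 < a) {ζ : ℝ → ℝ} {C : NNReal}
    (hζ_lip : LipschitzWith C ζ) (hζ_mem : ∀ t, ζ t ∈ Icc 0 a) :
    ∃ σ σ' : ℕ → ℝ → ℝ, (∀ n t, HasDerivAt (σ n) (σ' n t) t) ∧ (∀ n, Continuous (σ' n)) ∧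
      (∀ n, ∃ d > (0 : ℝ), ∀ t, σ n t ∈ Icc d (a - d)) ∧
      (∀ n t, |σ' n t| ≤ C) ∧ (∀ t, Tendsto (fun n => σ n t) atTop (𝓝 (ζ t))) ∧
      ∀ t v, HasDerivAt ζ v t → Tendsto (fun n => σ' n t) atTop (𝓝 v) := by
  have hζ_cont : Continuous ζ := hζ_lip.continuous
  set F : ℝ → ℝ := fun t => ∫ τ in (0 : ℝ)..t, ζ τ with hF
  have hFd : ∀ t, HasDerivAt F (ζ t) t := fun t =>
    intervalIntegral.integral_hasDerivAt_right (hζ_cont.intervalIntegrable _ _)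
      (hζ_cont.stronglyMeasurableAtFilter _ _) hζ_cont.continuousAt
  set h : ℕ → ℝ := fun n => 1 / ((n : ℝ) + 2) with hh
  have hh0 : ∀ n, 0 < h n := fun n => by simp only [hh]; positivity
  have hh1 : ∀ n, h n < 1 := fun n => by
    simp only [hh]; rw [div_lt_one (by positivity)]; linarith [n.cast_nonneg (α := ℝ)]
  have hhlim : Tendsto h atTop (𝓝 0) := by
    have := tendsto_const_div_atTop_nhds_zero_nat (1 : ℝ)
    have h2 := (tendsto_add_atTop_iff_nat 2).2 this
    simpa [hh] using h2
  have hhlim' : Tendsto h atTop (𝓝[≠] 0) :=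
    tendsto_nhdsWithin_iff.2 ⟨hhlim, Eventually.of_forall fun n => (hh0 n).ne'⟩
  set σ : ℕ → ℝ → ℝ := fun n t =>
    (1 - h n) * ((h n)⁻¹ * (F (t + h n) - F t)) + h n * (a / 2) with hσ
  set σ' : ℕ → ℝ → ℝ := fun n t => (1 - h n) * ((h n)⁻¹ * (ζ (t + h n) - ζ t)) with hσ'
  have hσd : ∀ n t, HasDerivAt (σ n) (σ' n t) t := fun n t =>
    (((((hFd (t + h n)).comp_add_const t (h n)).sub (hFd t)).const_mul _).const_mul _).add_const _
  have hσ'c : ∀ n, Continuous (σ' n) := fun n => by simp only [hσ']; fun_prop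
  have hσ_mem : ∀ n t, σ n t ∈ Icc (h n * (a / 2)) (a - h n * (a / 2)) := by
    intro n t
    obtain ⟨c, -, hc⟩ := exists_hasDerivAt_eq_slope F ζ (lt_add_of_pos_right t (hh0 n))
      (continuous_iff_continuousAt.2 fun t => (hFd t).continuousAt).continuousOn
      fun x _ => hFd x
    have hc' : (h n)⁻¹ * (F (t + h n) - F t) = ζ c := by
      rw [hc, add_sub_cancel_left, div_eq_inv_mul]
    have h1 := hζ_mem c
    simp only [hσ, hc']
    have h2 := hh1 n
    constructor <;> nlinarith [h1.1, h1.2]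
  have hσ'_bd : ∀ n t, |σ' n t| ≤ C := by
    intro n t
    have h1 := hζ_lip.dist_le_mul (t + h n) t
    rw [Real.dist_eq, Real.dist_eq, add_sub_cancel_left, abs_of_pos (hh0 n)] at h1
    have h2 : |(h n)⁻¹ * (ζ (t + h n) - ζ t)| ≤ C := by
      rw [abs_mul, abs_of_pos (inv_pos.2 (hh0 n)), inv_mul_le_iff₀ (hh0 n), mul_comm]
      exact h1
    simp only [hσ']
    rw [abs_mul, abs_of_pos (sub_pos.2 (hh1 n))]
    nlinarith [hh0 n, hh1 n, abs_nonneg ((h n)⁻¹ * (ζ (t + h n) - ζ t))]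
  have h_one_sub : Tendsto (fun n => 1 - h n) atTop (𝓝 1) := by
    simpa using hhlim.const_sub 1
  have hσ_lim : ∀ t, Tendsto (fun n => σ n t) atTop (𝓝 (ζ t)) := by
    intro t
    have h1 := (hFd t).tendsto_slope_zero.comp hhlim'
    have h2 := (h_one_sub.mul h1).add (hhlim.mul_const (a / 2))
    simpa [hσ, Function.comp_def] using h2
  have hσ'_lim : ∀ t v, HasDerivAt ζ v t → Tendsto (fun n => σ' n t) atTop (𝓝 v) := by
    intro t v hv
    have h1 := hv.tendsto_slope_zero.comp hhlim'
    simpa [hσ', Function.comp_def] using h_one_sub.mul h1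
  exact ⟨σ, σ', hσd, hσ'c, fun n => ⟨h n * (a / 2), mul_pos (hh0 n) (half_pos ha), hσ_mem n⟩,
    hσ'_bd, hσ_lim, hσ'_lim⟩

/-- Lemma `fiori`, single arc: a Lipschitz viscosity subsolution of
`u_t + H(s, u') = 0` satisfies the Lax–Oleinik type curve estimate with the
Fenchel conjugate Lagrangian `L`. -/
theorem subsolution_curve_estimate
    (a T : ℝ) (ha : 0 < a) (hT : 0 < T)
    (H : ℝ → ℝ → ℝ)
    (hHcont : Continuous (fun p : ℝ × ℝ => H p.1 p.2))
    (hHconv : ∀ s, ConvexOn ℝ Set.univ (H s))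
    (hHsuper : ∀ C > (0 : ℝ), ∃ R : ℝ, ∀ s ∈ Set.Icc 0 a, ∀ μ : ℝ,
      H s μ ≥ C * |μ| - R)
    (u : ℝ × ℝ → ℝ) (K : NNReal)
    (hu : LipschitzOnWith K u (Set.Icc 0 a ×ˢ Set.Icc 0 T))
    (hsub : ∀ φ : ℝ × ℝ → ℝ, ContDiff ℝ 1 φ →
      ∀ s₀ ∈ Set.Ioo (0 : ℝ) a, ∀ t₀ ∈ Set.Ioo (0 : ℝ) T,
      IsLocalMax (fun p => u p - φ p) (s₀, t₀) →
      deriv (fun τ => φ (s₀, τ)) t₀ + H s₀ (deriv (fun σ => φ (σ, t₀)) s₀) ≤ 0)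
    (t₁ t₂ : ℝ) (ht₁ : 0 ≤ t₁) (ht₁₂ : t₁ < t₂) (ht₂ : t₂ ≤ T)
    (η η' : ℝ → ℝ) (Kη : NNReal)
    (hη_lip : LipschitzOnWith Kη η (Set.Icc t₁ t₂))
    (hη_mem : ∀ t ∈ Set.Icc t₁ t₂, η t ∈ Set.Icc (0 : ℝ) a)
    (hη_deriv : ∀ᵐ t ∂(MeasureTheory.volume.restrict (Set.Icc t₁ t₂)),
      HasDerivAt η (η' t) t) :
    u (η t₂, t₂) - u (η t₁, t₁) ≤
      ∫ t in t₁..t₂, sSup (Set.range fun μ => μ * η' t - H (η t) μ) := by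
  have hT₁₂ : Icc t₁ t₂ ⊆ Icc 0 T := Icc_subset_Icc ht₁ ht₂
  obtain ⟨R₀, hR₀⟩ := exists_forall_sSup_eq_truncatedConjugate hHcont hHsuper Kη.coe_nonneg
  set R := max R₀ (2 * K) with hR
  set ζ : ℝ → ℝ := IccExtend ht₁₂.le ((Icc t₁ t₂).domRestrict η) with hζ
  have hζ_lip : LipschitzWith Kη ζ := by
    have := (hη_lip.to_restrict).comp (LipschitzWith.projIcc ht₁₂.le)
    rwa [mul_one] at this
  have hζ_eq : ∀ t ∈ Icc t₁ t₂, ζ t = η t := fun t ht => IccExtend_of_mem _ _ ht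
  have hζ_mem : ∀ t, ζ t ∈ Icc 0 a := fun t => hη_mem _ (projIcc t₁ t₂ ht₁₂.le t).2
  obtain ⟨σ, σ', hσd, hσ'c, hσ_mem, hσ'_bd, hσ_lim, hσ'_lim⟩ :=
    exists_contDiff_interior_approximation ha hζ_lip hζ_mem
  have hσc : ∀ n, Continuous (σ n) := fun n =>
    continuous_iff_continuousAt.2 fun t => (hσd n t).continuousAt
  have hσ_mem' : ∀ n t, σ n t ∈ Icc 0 a := fun n t => by
    obtain ⟨d, hd, h⟩ := hσ_mem n
    exact ⟨by linarith [(h t).1], by linarith [(h t).2]⟩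
  have hest : ∀ n, u (σ n t₂, t₂) - u (σ n t₁, t₁) ≤
      ∫ t in t₁..t₂, truncatedConjugate H R (σ n t) (σ' n t) := fun n => by
    obtain ⟨d, hd, h⟩ := hσ_mem n
    exact curve_estimate_of_continuous_deriv hHcont hu hsub ht₁ ht₁₂ ht₂ (hσd n) (hσ'c n)
      hd (fun t _ => h t) (le_max_right _ _)
  have hLc := continuous_truncatedConjugate hHcont R
  obtain ⟨B, hB⟩ := ((isCompact_Icc (a := (0 : ℝ)) (b := a)).prod
    (isCompact_Icc (a := -(Kη : ℝ)) (b := Kη))).exists_bound_of_continuousOn hLc.continuousOn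
  have hae : ∀ᵐ t, t ∈ uIoc t₁ t₂ → HasDerivAt ζ (η' t) t := by
    rw [ae_restrict_iff' measurableSet_Icc] at hη_deriv
    filter_upwards [hη_deriv, Measure.ae_ne volume t₂] with t h1 h2 h3
    rw [uIoc_of_le ht₁₂.le] at h3
    refine (h1 (Ioc_subset_Icc_self h3)).congr_of_eventuallyEq ?_
    filter_upwards [Icc_mem_nhds h3.1 (lt_of_le_of_ne h3.2 h2)] with x hx using hζ_eq x hx
  have hint : Tendsto (fun n => ∫ t in t₁..t₂, truncatedConjugate H R (σ n t) (σ' n t)) atTop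
      (𝓝 (∫ t in t₁..t₂, truncatedConjugate H R (ζ t) (η' t))) := by
    refine intervalIntegral.tendsto_integral_filter_of_dominated_convergence (fun _ => B)
      (Eventually.of_forall fun n =>
        (hLc.comp ((hσc n).prodMk (hσ'c n))).aestronglyMeasurable)
      (Eventually.of_forall fun n => Eventually.of_forall fun t _ =>
        hB (σ n t, σ' n t) ⟨hσ_mem' n t, abs_le.1 (hσ'_bd n t)⟩)
      intervalIntegrable_const ?_
    filter_upwards [hae] with t h1 h2
    exact (hLc.tendsto (ζ t, η' t)).comp ((hσ_lim t).prodMk_nhds (hσ'_lim t _ (h1 h2)))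
  have hu_lim : ∀ t ∈ Icc t₁ t₂, Tendsto (fun n => u (σ n t, t)) atTop (𝓝 (u (η t, t))) := by
    intro t ht
    rw [← hζ_eq t ht]
    refine (hu.continuousOn (ζ t, t) ⟨hζ_mem t, hT₁₂ ht⟩).tendsto.comp
      (tendsto_nhdsWithin_iff.2 ⟨(hσ_lim t).prodMk_nhds tendsto_const_nhds,
        Eventually.of_forall fun n => ⟨hσ_mem' n t, hT₁₂ ht⟩⟩)
  refine (le_of_tendsto_of_tendsto' ((hu_lim t₂ (right_mem_Icc.2 ht₁₂.le)).sub
    (hu_lim t₁ (left_mem_Icc.2 ht₁₂.le))) hint hest).trans_eq ?_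
  refine intervalIntegral.integral_congr_ae ?_
  filter_upwards [hae] with t h1 h2
  have hv : |η' t| ≤ Kη := le_of_tendsto' (hσ'_lim t _ (h1 h2)).abs fun n => hσ'_bd n t
  rw [uIoc_of_le ht₁₂.le] at h2
  rw [← hζ_eq t (Ioc_subset_Icc_self h2)]
  exact (hR₀ R (le_max_left _ _) (ζ t) (hζ_mem t) (η' t) hv).symm
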